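/- Let V be a finite set of VNFs with reliabilities p_v ∈ [0,1] for v ∈ V, and let l ∈ ℕ with l ≥ 1. Then the M/M/m subchaining structure is at least as reliable as the M/M/1 subchaining structure with the same number l of parallel copies: ∏_{v ∈ V} (1 − (1 − p_v)^l) ≥ 1 − (1 − ∏_{v ∈ V} p_v)^l. -/

import Mathlib

/-- The probabilistic sum `x + y - x * y` on `[0, 1]` satisfies a power inequality. -/
lemma pow_add_pow_sub_mul_le_pow {x y : ℝ} (hx0 : 0 ≤ x) (hx1 : x ≤ 1) (hy0 : 0 ≤ y)
    (hy1 : y ≤ 1) (n : ℕ) : x ^ n + y ^ n - x ^ n * y ^ n ≤ (x + y - x * y) ^ n := by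
  induction n with
  | zero => simp
  | succ n ih =>
    have hs : 0 ≤ x + y - x * y := by nlinarith
    have hx : 0 ≤ 1 - x := sub_nonneg.2 hx1
    have hy : 0 ≤ 1 - y := sub_nonneg.2 hy1
    have hxn : 0 ≤ 1 - x ^ n := sub_nonneg.2 (pow_le_one₀ hx0 hx1)
    have hyn : 0 ≤ 1 - y ^ n := sub_nonneg.2 (pow_le_one₀ hy0 hy1)
    have h₁ : 0 ≤ x * y ^ n * (1 - y) * (1 - x ^ n) := by positivity
    have h₂ : 0 ≤ y * x ^ n * (1 - x) * (1 - y ^ n) := by positivity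
    calc x ^ (n + 1) + y ^ (n + 1) - x ^ (n + 1) * y ^ (n + 1)
        ≤ (x ^ n + y ^ n - x ^ n * y ^ n) * (x + y - x * y) := by
          simp only [pow_succ]
          linarith
      _ ≤ (x + y - x * y) ^ n * (x + y - x * y) := by gcongr
      _ = (x + y - x * y) ^ (n + 1) := (pow_succ _ _).symm

/-- Replicating each of two components in series is at least as reliable as replicating the
whole series system. -/
lemma one_sub_one_sub_mul_pow_le {a b : ℝ} (ha0 : 0 ≤ a) (ha1 : a ≤ 1) (hb0 : 0 ≤ b)
    (hb1 : b ≤ 1) (n : ℕ) :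
    1 - (1 - a * b) ^ n ≤ (1 - (1 - a) ^ n) * (1 - (1 - b) ^ n) := by
  have h := pow_add_pow_sub_mul_le_pow (sub_nonneg.2 ha1) (sub_le_self 1 ha0)
    (sub_nonneg.2 hb1) (sub_le_self 1 hb0) n
  rw [show 1 - a + (1 - b) - (1 - a) * (1 - b) = 1 - a * b by ring] at h
  linarith

/-- With the same number `l ≥ 1` of parallel copies, the M/M/m
subchaining structure is at least as reliable as the M/M/1 subchaining structure:
`∏ v (1 - (1 - p v)^l) ≥ 1 - (1 - ∏ v p v)^l`. -/
theorem mmm_reliability_ge_mm1_reliability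
    {ι : Type*} (V : Finset ι) (p : ι → ℝ) (l : ℕ)
    (hp0 : ∀ v ∈ V, 0 ≤ p v) (hp1 : ∀ v ∈ V, p v ≤ 1)
    (hl : 1 ≤ l) :
    ∏ v ∈ V, (1 - (1 - p v) ^ l) ≥ 1 - (1 - ∏ v ∈ V, p v) ^ l := by
  induction V using Finset.cons_induction with
  | empty => simp
  | cons a s ha ih =>
    simp only [Finset.mem_cons, forall_eq_or_imp] at hp0 hp1
    have h : 0 ≤ 1 - (1 - p a) ^ l :=
      sub_nonneg.2 (pow_le_one₀ (sub_nonneg.2 hp1.1) (sub_le_self 1 hp0.1))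
    rw [Finset.prod_cons, Finset.prod_cons]
    exact (one_sub_one_sub_mul_pow_le hp0.1 hp1.1 (Finset.prod_nonneg hp0.2)
      (Finset.prod_le_one hp0.2 hp1.2) l).trans
      (mul_le_mul_of_nonneg_left (ih hp0.2 hp1.2) h)
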